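/- Let D be connected and let L be a two-dimensional complex Finsler metric on D satisfying the weak symmetry condition R_{r̄kh̄s}η̄^rη̄^hη^s = R_{r̄sh̄k}η̄^rη^sη̄^h (for k ∈ {1,2}) at every point of D, with A nowhere zero on D, and suppose the horizontal curvature invariant K equals a nonzero constant on D. Then L is weakly Kähler. -/

import Mathlib

open Complex

noncomputable section

namespace CFinsler

/-- A point of `T'M` in local coordinates: `(z, η) ∈ ℂⁿ × ℂⁿ`. -/
abbrev Pt (n : ℕ) := (Fin n → ℂ) × (Fin n → ℂ)

variable {n : ℕ}

/-- Wirtinger derivative `∂f/∂z^k`. -/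
def dz (f : Pt n → ℂ) (k : Fin n) (p : Pt n) : ℂ :=
  (1 / 2) * (fderiv ℝ f p ((Pi.single k 1 : Fin n → ℂ), 0) -
    Complex.I * fderiv ℝ f p ((Pi.single k Complex.I : Fin n → ℂ), 0))

/-- Wirtinger derivative `∂f/∂z̄^k`. -/
def dzbar (f : Pt n → ℂ) (k : Fin n) (p : Pt n) : ℂ :=
  (1 / 2) * (fderiv ℝ f p ((Pi.single k 1 : Fin n → ℂ), 0) +
    Complex.I * fderiv ℝ f p ((Pi.single k Complex.I : Fin n → ℂ), 0))

/-- Wirtinger derivative `∂f/∂η^k`. -/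
def de (f : Pt n → ℂ) (k : Fin n) (p : Pt n) : ℂ :=
  (1 / 2) * (fderiv ℝ f p (0, (Pi.single k 1 : Fin n → ℂ)) -
    Complex.I * fderiv ℝ f p (0, (Pi.single k Complex.I : Fin n → ℂ)))

/-- Wirtinger derivative `∂f/∂η̄^k`. -/
def debar (f : Pt n → ℂ) (k : Fin n) (p : Pt n) : ℂ :=
  (1 / 2) * (fderiv ℝ f p (0, (Pi.single k 1 : Fin n → ℂ)) +
    Complex.I * fderiv ℝ f p (0, (Pi.single k Complex.I : Fin n → ℂ)))

/-- The fundamental metric tensor `g_{i j̄} := ∂²L/∂η^i ∂η̄^j`. -/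
def gm (L : Pt n → ℂ) (i j : Fin n) : Pt n → ℂ := de (debar L j) i

/-- `L` is an `n`-dimensional complex Finsler metric on `D`. -/
structure IsCFM (n : ℕ) (D : Set (Pt n)) (L : Pt n → ℂ) : Prop where
  openD : IsOpen D
  fiber_ne : ∀ p ∈ D, p.2 ≠ 0
  conic : ∀ p ∈ D, ∀ lam : ℂ, lam ≠ 0 → (p.1, lam • p.2) ∈ D
  smooth : ContDiffOn ℝ (⊤ : ℕ∞) L D
  real_im : ∀ p ∈ D, (L p).im = 0
  pos : ∀ p ∈ D, 0 < (L p).re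
  homog : ∀ p ∈ D, ∀ lam : ℂ, lam ≠ 0 →
    L (p.1, lam • p.2) = ((Complex.normSq lam : ℝ) : ℂ) * L p
  hermitian : ∀ p ∈ D, ∀ i j, (starRingEnd ℂ) (gm L i j p) = gm L j i p
  posdef : ∀ p ∈ D, ∀ v : Fin n → ℂ, v ≠ 0 →
    0 < (∑ i, ∑ j, gm L i j p * v i * (starRingEnd ℂ) (v j)).re

variable (L : Pt n → ℂ)

/-- The metric tensor as a matrix at a point. -/
def gmat (p : Pt n) : Matrix (Fin n) (Fin n) ℂ := fun i j => gm L i j p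

/-- The inverse metric tensor `g^{l̄ i}`. -/
def gi (l i : Fin n) (p : Pt n) : ℂ := (gmat L p)⁻¹ l i

/-- The Chern–Finsler nonlinear connection coefficients
`N^i_k := g^{m̄ i} (∂g_{l m̄}/∂z^k) η^l`. -/
def Nc (i k : Fin n) (p : Pt n) : ℂ :=
  ∑ m, ∑ l, gi L m i p * dz (gm L l m) k p * p.2 l

/-- The horizontal derivation `δ_k := ∂/∂z^k − N^j_k ∂/∂η^j`. -/
def del (f : Pt n → ℂ) (k : Fin n) (p : Pt n) : ℂ :=
  dz f k p - ∑ j, Nc L j k p * de f j p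

/-- The conjugate horizontal derivation `δ_k̄ := ∂/∂z̄^k − N̄^j_k ∂/∂η̄^j`. -/
def delbar (f : Pt n → ℂ) (k : Fin n) (p : Pt n) : ℂ :=
  dzbar f k p - ∑ j, (starRingEnd ℂ) (Nc L j k p) * debar f j p

/-- The horizontal Chern–Finsler connection coefficients `L^i_{jk} := g^{l̄ i} δ_k(g_{j l̄})`. -/
def Lc (i j k : Fin n) (p : Pt n) : ℂ := ∑ l, gi L l i p * del L (gm L j l) k p

/-- The vertical Chern–Finsler connection coefficients `C^i_{jk} := g^{l̄ i} ∂g_{j l̄}/∂η^k`. -/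
def Cc (i j k : Fin n) (p : Pt n) : ℂ := ∑ l, gi L l i p * de (gm L j l) k p

/-- The spray coefficients `G^i := ½ N^i_j η^j`. -/
def Gs (i : Fin n) (p : Pt n) : ℂ := (1 / 2) * ∑ j, Nc L i j p * p.2 j

/-- The canonical horizontal derivation `δ̊_k := ∂/∂z^k − (∂G^j/∂η^k) ∂/∂η^j`. -/
def delc (f : Pt n → ℂ) (k : Fin n) (p : Pt n) : ℂ :=
  dz f k p - ∑ j, de (Gs L j) k p * de f j p

/-- `F := √L`. -/
def Fh (p : Pt n) : ℂ := (Real.sqrt ((L p).re) : ℂ)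

/-- `l^i := η^i / F`. -/
def lup (i : Fin n) (p : Pt n) : ℂ := p.2 i / Fh L p

/-- `l_i := g_{i j̄} η̄^j / F`. -/
def llow (i : Fin n) (p : Pt n) : ℂ :=
  (∑ j, gm L i j p * (starRingEnd ℂ) (p.2 j)) / Fh L p

/-- `√g` where `g := det(g_{i j̄})`. -/
def sg (p : Pt n) : ℂ := (Real.sqrt ((gmat L p).det.re) : ℂ)

/-- The metric is Kähler. -/
def IsKahler (D : Set (Pt n)) : Prop := ∀ p ∈ D, ∀ i j k, Lc L i j k p = Lc L i k j p

/-- The metric is weakly Kähler. -/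
def IsWeaklyKahler (D : Set (Pt n)) : Prop :=
  ∀ p ∈ D, ∀ k, (∑ i, ∑ j, ∑ l, gm L i l p * (Lc L i j k p - Lc L i k j p) *
    p.2 j * (starRingEnd ℂ) (p.2 l)) = 0

/-- The metric is purely Hermitian: `g_{i j̄}` does not depend on the fibre variable. -/
def IsPurelyHermitian (D : Set (Pt n)) : Prop :=
  ∀ p ∈ D, ∀ i j k, de (gm L i j) k p = 0 ∧ debar (gm L i j) k p = 0

/-- The metric is a complex Berwald metric: Kähler with `L^i_{jk}` independent of the
fibre variable. -/
def IsBerwald (D : Set (Pt n)) : Prop :=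
  IsKahler L D ∧ ∀ p ∈ D, ∀ i j k l, de (Lc L i j k) l p = 0 ∧ debar (Lc L i j k) l p = 0

/-- The metric is a complex Landsberg metric: the Berwald and Rund connections coincide. -/
def IsLandsberg (D : Set (Pt n)) : Prop :=
  ∀ p ∈ D, ∀ i j k, de (de (Gs L i) k) j p =
    (1 / 2) * ∑ l, gi L l i p * (delc L (gm L j l) k p + delc L (gm L k l) j p)

/-- `m^i` of the local complex Berwald frame: `m¹ = −l₂/√g`, `m² = l₁/√g`. -/
def mup (L : Pt 2 → ℂ) (i : Fin 2) (p : Pt 2) : ℂ :=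
  if i = 0 then -(llow L 1 p) / sg L p else llow L 0 p / sg L p

/-- `m_i := g_{i j̄} m̄^j`. -/
def mlow (L : Pt 2 → ℂ) (i : Fin 2) (p : Pt 2) : ℂ :=
  ∑ j, gm L i j p * (starRingEnd ℂ) (mup L j p)

/-- `A := m^j m^k l_h C^h_{kj}`. -/
def sA (L : Pt 2 → ℂ) (p : Pt 2) : ℂ :=
  ∑ j, ∑ k, ∑ h, mup L j p * mup L k p * llow L h p * Cc L h k j p

/-- `B := m_h m^k m^j C^h_{jk}`. -/
def sB (L : Pt 2 → ℂ) (p : Pt 2) : ℂ :=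
  ∑ j, ∑ k, ∑ h, mlow L h p * mup L k p * mup L j p * Cc L h j k p

/-- `J := l^j l^k l_i L^i_{jk}`. -/
def sJ (L : Pt 2 → ℂ) (p : Pt 2) : ℂ :=
  ∑ j, ∑ k, ∑ i, lup L j p * lup L k p * llow L i p * Lc L i j k p

/-- `U := m^j l^k l_i L^i_{jk}`. -/
def sU (L : Pt 2 → ℂ) (p : Pt 2) : ℂ :=
  ∑ j, ∑ k, ∑ i, mup L j p * lup L k p * llow L i p * Lc L i j k p

/-- `V := l^j m^k l_i L^i_{jk}`. -/
def sV (L : Pt 2 → ℂ) (p : Pt 2) : ℂ :=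
  ∑ j, ∑ k, ∑ i, lup L j p * mup L k p * llow L i p * Lc L i j k p

/-- `X := m^j m^k l_i L^i_{jk}`. -/
def sX (L : Pt 2 → ℂ) (p : Pt 2) : ℂ :=
  ∑ j, ∑ k, ∑ i, mup L j p * mup L k p * llow L i p * Lc L i j k p

/-- `O := l^j l^k m_i L^i_{jk}`. -/
def sO (L : Pt 2 → ℂ) (p : Pt 2) : ℂ :=
  ∑ j, ∑ k, ∑ i, lup L j p * lup L k p * mlow L i p * Lc L i j k p

/-- `Y := m^j l^k m_i L^i_{jk}`. -/
def sY (L : Pt 2 → ℂ) (p : Pt 2) : ℂ :=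
  ∑ j, ∑ k, ∑ i, mup L j p * lup L k p * mlow L i p * Lc L i j k p

/-- `E := l^j m^k m_i L^i_{jk}`. -/
def sE (L : Pt 2 → ℂ) (p : Pt 2) : ℂ :=
  ∑ j, ∑ k, ∑ i, lup L j p * mup L k p * mlow L i p * Lc L i j k p

/-- `H := m^j m^k m_i L^i_{jk}`. -/
def sH (L : Pt 2 → ℂ) (p : Pt 2) : ℂ :=
  ∑ j, ∑ k, ∑ i, mup L j p * mup L k p * mlow L i p * Lc L i j k p

/-- The vertical curvature invariant `I := −(∂B/∂η̄^s) m̄^s − B B̄/2`. -/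
def vI (L : Pt 2 → ℂ) (p : Pt 2) : ℂ :=
  -(∑ s, debar (sB L) s p * (starRingEnd ℂ) (mup L s p)) -
    sB L p * (starRingEnd ℂ) (sB L p) / 2

/-- The `v v̄`-Riemann type tensor `S_{r̄ j h̄ k} := −g_{i r̄} ∂C^i_{jk}/∂η̄^h`. -/
def Sv (L : Pt 2 → ℂ) (r j h k : Fin 2) (p : Pt 2) : ℂ :=
  -∑ i, gm L i r p * debar (Cc L i j k) h p

/-- The `h h̄`-Riemann type tensor
`R_{r̄ j h̄ k} := g_{i r̄} (−δ_h̄(L^i_{jk}) − δ_h̄(N^l_k) C^i_{jl})`. -/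
def Rh (L : Pt 2 → ℂ) (r j h k : Fin 2) (p : Pt 2) : ℂ :=
  ∑ i, gm L i r p *
    (-(delbar L (Lc L i j k) h p) - ∑ l, delbar L (Nc L l k) h p * Cc L i j l p)

/-- The horizontal curvature invariant `K := −(1/F) δ_k̄(J) η̄^k`. -/
def hK (L : Pt 2 → ℂ) (p : Pt 2) : ℂ :=
  -(1 / Fh L p) * ∑ k, delbar L (sJ L) k p * (starRingEnd ℂ) (p.2 k)

/-- The horizontal curvature invariant
`W := −δ_s̄(H) m̄^s − ½ H (V̄+H̄) − B F δ_s̄(E) m̄^s`. -/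
def hW (L : Pt 2 → ℂ) (p : Pt 2) : ℂ :=
  -(∑ s, delbar L (sH L) s p * (starRingEnd ℂ) (mup L s p)) -
    (1 / 2) * sH L p * ((starRingEnd ℂ) (sV L p) + (starRingEnd ℂ) (sH L p)) -
    sB L p * Fh L p * ∑ s, delbar L (sE L) s p * (starRingEnd ℂ) (mup L s p)

/-- The weak symmetry condition `R_{0̄ k 0̄ 0} = R_{0̄ 0 0̄ k}`, i.e.
`R_{r̄ k h̄ s} η̄^r η̄^h η^s = R_{r̄ s h̄ k} η̄^r η^s η̄^h`. -/
def WeakSym (L : Pt 2 → ℂ) (D : Set (Pt 2)) : Prop :=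
  ∀ p ∈ D, ∀ k,
    (∑ r, ∑ h, ∑ s, Rh L r k h s p * (starRingEnd ℂ) (p.2 r) *
      (starRingEnd ℂ) (p.2 h) * p.2 s) =
    ∑ r, ∑ s, ∑ h, Rh L r s h k p * (starRingEnd ℂ) (p.2 r) * p.2 s *
      (starRingEnd ℂ) (p.2 h)

section SmoothAlgebra

variable {V : Type*} {D : Set V}

open scoped Classical in
/-- Extension by zero of a function on `D`. -/
def extendZero (f : D → ℂ) (p : V) : ℂ := if h : p ∈ D then f ⟨p, h⟩ else 0

lemma extendZero_coe (f : D → ℂ) (p : D) : extendZero f p = f p := by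
  simp [extendZero]

variable [NormedAddCommGroup V] [NormedSpace ℝ V]

/-- The algebra of smooth complex-valued functions on `D`. -/
def smoothAlgebra (D : Set V) : Subalgebra ℂ (D → ℂ) where
  carrier := {f | ContDiffOn ℝ (⊤ : ℕ∞) (extendZero f) D}
  mul_mem' {f g} hf hg := (ContDiffOn.mul hf hg).congr fun p hp => by
    simp [extendZero, hp]
  add_mem' {f g} hf hg := (ContDiffOn.add hf hg).congr fun p hp => by
    simp [extendZero, hp]
  algebraMap_mem' c := (contDiffOn_const (c := c)).congr fun p hp => by
    simp [extendZero, hp]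

/-- The element `r` of the smooth algebra is the restriction of `f` to `D`. -/
def Represents (r : smoothAlgebra D) (f : V → ℂ) : Prop := ∀ p : D, r.1 p = f p

/-- The restriction to `D` of a function smooth on `D`. -/
def smoothRestrict (f : V → ℂ) (hf : ContDiffOn ℝ (⊤ : ℕ∞) f D) : smoothAlgebra D :=
  ⟨fun p => f p, hf.congr fun p hp => by simp [extendZero, hp]⟩

lemma represents_extendZero (r : smoothAlgebra D) : Represents r (extendZero r.1) :=
  fun p => (extendZero_coe _ p).symm

lemma smoothAlgebra_contDiffAt (hD : IsOpen D) (r : smoothAlgebra D) (p : D) :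
    ContDiffAt ℝ (⊤ : ℕ∞) (extendZero r.1) p :=
  ContDiffOn.contDiffAt r.2 (hD.mem_nhds p.2)

lemma Represents.fderiv_eq (hD : IsOpen D) {r : smoothAlgebra D} {f : V → ℂ}
    (h : Represents r f) (p : D) : fderiv ℝ (extendZero r.1) p = fderiv ℝ f p := by
  apply Filter.EventuallyEq.fderiv_eq
  filter_upwards [hD.mem_nhds p.2] with q hq
  rw [← h ⟨q, hq⟩, ← extendZero_coe r.1 ⟨q, hq⟩]

lemma Represents.contDiffOn {r : smoothAlgebra D} {f : V → ℂ} (h : Represents r f) :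
    ContDiffOn ℝ (⊤ : ℕ∞) f D :=
  ContDiffOn.congr r.2 fun q hq => by
    rw [← h ⟨q, hq⟩, ← extendZero_coe r.1 ⟨q, hq⟩]

lemma Represents.differentiableAt (hD : IsOpen D) {r : smoothAlgebra D} {f : V → ℂ}
    (h : Represents r f) (p : D) : DifferentiableAt ℝ f p :=
  (h.contDiffOn.contDiffAt (hD.mem_nhds p.2)).differentiableAt (by simp)

lemma contDiffOn_fderiv_apply (hD : IsOpen D) {f : V → ℂ} (hf : ContDiffOn ℝ (⊤ : ℕ∞) f D)
    (v : V) : ContDiffOn ℝ (⊤ : ℕ∞) (fun p => fderiv ℝ f p v) D :=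
  (hf.fderiv_of_isOpen hD (by simp)).clm_apply contDiffOn_const

/-- The directional derivative along a real vector, as a complex derivation. -/
def dirDeriv (hD : IsOpen D) (v : V) : Derivation ℂ (smoothAlgebra D) (smoothAlgebra D) :=
  Derivation.mk'
    { toFun r := smoothRestrict (fun p => fderiv ℝ (extendZero r.1) p v)
        (contDiffOn_fderiv_apply hD r.2 v)
      map_add' r s := by
        ext p
        have h : Represents (r + s) (fun q => extendZero r.1 q + extendZero s.1 q) := fun q => by
          simp [extendZero_coe]
        simp only [smoothRestrict, h.fderiv_eq hD]
        rw [fderiv_fun_add ((represents_extendZero r).differentiableAt hD p)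
          ((represents_extendZero s).differentiableAt hD p)]
        rfl
      map_smul' c r := by
        ext p
        have h : Represents (c • r) (fun q => c * extendZero r.1 q) := fun q => by
          simp [extendZero_coe]
        simp only [smoothRestrict, h.fderiv_eq hD]
        rw [fderiv_const_mul ((represents_extendZero r).differentiableAt hD p)]
        rfl }
    fun r s => by
      ext p
      have h : Represents (r * s) (fun q => extendZero r.1 q * extendZero s.1 q) := fun q => by
        simp [extendZero_coe]
      simp only [smoothRestrict, LinearMap.coe_mk, AddHom.coe_mk, h.fderiv_eq hD]
      rw [fderiv_fun_mul ((represents_extendZero r).differentiableAt hD p)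
          ((represents_extendZero s).differentiableAt hD p)]
      simp [extendZero_coe]

lemma dirDeriv_apply (hD : IsOpen D) (v : V) {r : smoothAlgebra D} {f : V → ℂ}
    (h : Represents r f) (p : D) : (dirDeriv hD v r).1 p = fderiv ℝ f p v := by
  rw [← h.fderiv_eq hD]
  rfl

lemma dirDeriv_comm (hD : IsOpen D) (v w : V) (r : smoothAlgebra D) :
    dirDeriv hD v (dirDeriv hD w r) = dirDeriv hD w (dirDeriv hD v r) := by
  ext p
  have h (v : V) : Represents (dirDeriv hD v r) (fun q => fderiv ℝ (extendZero r.1) q v) :=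
    dirDeriv_apply hD v (represents_extendZero r)
  have hr := smoothAlgebra_contDiffAt hD r p
  have hd : DifferentiableAt ℝ (fderiv ℝ (extendZero r.1)) p :=
    (hr.fderiv_right (m := 1) (by norm_cast)).differentiableAt (by simp)
  rw [dirDeriv_apply hD v (h w), dirDeriv_apply hD w (h v),
    fderiv_clm_apply hd (by fun_prop), fderiv_clm_apply hd (by fun_prop)]
  have hs : IsSymmSndFDerivAt ℝ (extendZero r.1) p :=
    hr.isSymmSndFDerivAt (by simp only [minSmoothness_of_isRCLikeNormedField]; norm_cast)
  simpa using hs.eq v w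

/-- Pointwise complex conjugation on the smooth algebra. -/
def smoothConj : smoothAlgebra D →+* smoothAlgebra D where
  toFun r := smoothRestrict (fun p => conjCLE (extendZero r.1 p))
    (conjCLE.contDiff.comp_contDiffOn r.2)
  map_one' := by ext p; simp [smoothRestrict, extendZero_coe]
  map_zero' := by ext p; simp [smoothRestrict, extendZero_coe]
  map_mul' r s := by ext p; simp [smoothRestrict, extendZero_coe]
  map_add' r s := by ext p; simp [smoothRestrict, extendZero_coe]

lemma smoothConj_apply (r : smoothAlgebra D) (p : D) :
    (smoothConj r).1 p = (starRingEnd ℂ) (r.1 p) := by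
  simp [smoothConj, smoothRestrict, extendZero_coe]

lemma smoothConj_smul (c : ℂ) (r : smoothAlgebra D) :
    smoothConj (c • r) = (starRingEnd ℂ) c • smoothConj r := by
  ext p
  simp [smoothConj_apply]

lemma smoothConj_dirDeriv (hD : IsOpen D) (v : V) (r : smoothAlgebra D) :
    smoothConj (dirDeriv hD v r) = dirDeriv hD v (smoothConj r) := by
  ext p
  have h : Represents (smoothConj r) (conjCLE ∘ extendZero r.1) := fun _ => rfl
  rw [smoothConj_apply, dirDeriv_apply hD v h, dirDeriv_apply hD v (represents_extendZero r),
    conjCLE.comp_fderiv]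
  simp

/-- The Wirtinger derivation `½(∂_v - i ∂_w)`. -/
def wirtinger (hD : IsOpen D) (v w : V) : Derivation ℂ (smoothAlgebra D) (smoothAlgebra D) :=
  (1 / 2 : ℂ) • (dirDeriv hD v - I • dirDeriv hD w)

/-- The Wirtinger derivation `½(∂_v + i ∂_w)`. -/
def wirtingerBar (hD : IsOpen D) (v w : V) : Derivation ℂ (smoothAlgebra D) (smoothAlgebra D) :=
  (1 / 2 : ℂ) • (dirDeriv hD v + I • dirDeriv hD w)

lemma wirtinger_apply (hD : IsOpen D) (v w : V) (r : smoothAlgebra D) :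
    wirtinger hD v w r = (1 / 2 : ℂ) • (dirDeriv hD v r - I • dirDeriv hD w r) := rfl

lemma wirtingerBar_apply (hD : IsOpen D) (v w : V) (r : smoothAlgebra D) :
    wirtingerBar hD v w r = (1 / 2 : ℂ) • (dirDeriv hD v r + I • dirDeriv hD w r) := rfl

lemma wirtinger_comm (hD : IsOpen D) (v w v' w' : V) (r : smoothAlgebra D) :
    wirtinger hD v w (wirtinger hD v' w' r) = wirtinger hD v' w' (wirtinger hD v w r) := by
  simp only [wirtinger_apply, Derivation.map_smul, map_sub, dirDeriv_comm hD v' v,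
    dirDeriv_comm hD v' w, dirDeriv_comm hD w' v, dirDeriv_comm hD w' w]
  module

lemma wirtingerBar_wirtinger_comm (hD : IsOpen D) (v w v' w' : V) (r : smoothAlgebra D) :
    wirtingerBar hD v w (wirtinger hD v' w' r) = wirtinger hD v' w' (wirtingerBar hD v w r) := by
  simp only [wirtinger_apply, wirtingerBar_apply, Derivation.map_smul, map_sub, map_add,
    dirDeriv_comm hD v' v, dirDeriv_comm hD v' w, dirDeriv_comm hD w' v, dirDeriv_comm hD w' w]
  module

lemma smoothConj_wirtinger (hD : IsOpen D) (v w : V) (r : smoothAlgebra D) :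
    smoothConj (wirtinger hD v w r) = wirtingerBar hD v w (smoothConj r) := by
  simp [wirtinger_apply, wirtingerBar_apply, smoothConj_smul, smoothConj_dirDeriv, conj_ofNat]

lemma smoothConj_wirtingerBar (hD : IsOpen D) (v w : V) (r : smoothAlgebra D) :
    smoothConj (wirtingerBar hD v w r) = wirtinger hD v w (smoothConj r) := by
  simp [wirtinger_apply, wirtingerBar_apply, smoothConj_smul, smoothConj_dirDeriv, conj_ofNat,
    sub_eq_add_neg]

end SmoothAlgebra

/-- An algebraic model of the smooth functions on the domain of a two-dimensional complex
Finsler metric: commuting derivations `∂/∂z`, `∂/∂z̄`, `∂/∂η`, `∂/∂η̄` on a commutative algebra,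
fibre coordinates, a metric `L` satisfying the Euler identities, and the Chern–Finsler nonlinear
connection `N` together with its conjugate `Nb`. -/
structure FinslerAlgebra (R : Type*) [CommRing R] [Algebra ℂ R] where
  (Z Zb E Eb : Fin 2 → Derivation ℂ R R)
  (η ηb : Fin 2 → R)
  L : R
  (N Nb : Fin 2 → Fin 2 → R)
  Z_Z : ∀ i j f, Z i (Z j f) = Z j (Z i f)
  E_E : ∀ i j f, E i (E j f) = E j (E i f)
  Z_E : ∀ i j f, Z i (E j f) = E j (Z i f)
  Z_Eb : ∀ i j f, Z i (Eb j f) = Eb j (Z i f)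
  Zb_E : ∀ i j f, Zb i (E j f) = E j (Zb i f)
  Zb_Z : ∀ i j f, Zb i (Z j f) = Z j (Zb i f)
  Eb_E : ∀ i j f, Eb i (E j f) = E j (Eb i f)
  E_η : ∀ i j, E i (η j) = if i = j then 1 else 0
  Eb_η : ∀ i j, Eb i (η j) = 0
  Z_η : ∀ i j, Z i (η j) = 0
  Zb_η : ∀ i j, Zb i (η j) = 0
  E_ηb : ∀ i j, E i (ηb j) = 0
  Z_ηb : ∀ i j, Z i (ηb j) = 0
  euler : ∑ i, η i * E i L = L
  euler_bar : ∑ i, ηb i * Eb i L = L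
  metric_N : ∀ m k, ∑ i, E i (Eb m L) * N i k = Z k (Eb m L)
  metric_Nb : ∀ i h, ∑ j, E i (Eb j L) * Nb j h = Zb h (E i L)

namespace FinslerAlgebra

variable {R : Type*} [CommRing R] [Algebra ℂ R] (S : FinslerAlgebra R)

/-- The horizontal derivation `δ_k`. -/
def del (k : Fin 2) : Derivation ℂ R R := S.Z k - ∑ j, S.N j k • S.E j

/-- The conjugate horizontal derivation `δ_k̄`. -/
def delbar (k : Fin 2) : Derivation ℂ R R := S.Zb k - ∑ j, S.Nb j k • S.Eb j

/-- The derivation `η̄^h δ_h̄`. -/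
def radial : Derivation ℂ R R := ∑ h, S.ηb h • S.delbar h

/-- The conjugate spray `η̄^h N̄^j_h`. -/
def sprayBar (j : Fin 2) : R := ∑ h, S.ηb h * S.Nb j h

lemma del_apply (k : Fin 2) (f : R) : S.del k f = S.Z k f - ∑ j, S.N j k * S.E j f := by
  simp [del]

lemma delbar_apply (k : Fin 2) (f : R) :
    S.delbar k f = S.Zb k f - ∑ j, S.Nb j k * S.Eb j f := by
  simp [delbar]

lemma radial_apply (f : R) : S.radial f = ∑ h, S.ηb h * S.delbar h f := by
  simp [radial]

lemma radial_apply' (f : R) :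
    S.radial f = ∑ h, S.ηb h * S.Zb h f - ∑ j, S.sprayBar j * S.Eb j f := by
  simp only [radial_apply, delbar_apply, sprayBar, Fin.sum_univ_two]
  ring

lemma lower_eq (i : Fin 2) : ∑ m, E S i (S.Eb m S.L) * S.ηb m = S.E i S.L := by
  have h := congrArg (S.E i) S.euler_bar
  simp only [Fin.sum_univ_two, map_add, Derivation.leibniz, smul_eq_mul, E_ηb] at h ⊢
  linear_combination h

lemma euler_lower (i : Fin 2) : ∑ s, S.η s * S.E i (S.E s S.L) = 0 := by
  have h := congrArg (S.E i) S.euler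
  simp only [Fin.sum_univ_two, map_add, Derivation.leibniz, smul_eq_mul, E_η] at h ⊢
  fin_cases i <;> simp at h ⊢ <;> linear_combination h

lemma lower_N (k : Fin 2) : ∑ i, S.E i S.L * S.N i k = S.Z k S.L := by
  have h := congrArg (S.Z k) S.euler_bar
  have h0 := S.metric_N 0 k
  have h1 := S.metric_N 1 k
  simp only [← lower_eq]
  simp only [Fin.sum_univ_two, map_add, Derivation.leibniz, smul_eq_mul, Z_ηb] at *
  linear_combination h + S.ηb 0 * h0 + S.ηb 1 * h1

lemma del_metric (k : Fin 2) : S.del k S.L = 0 := by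
  rw [del_apply, ← lower_N]
  simp only [Fin.sum_univ_two]
  ring

lemma delbar_lower (h i : Fin 2) : S.delbar h (S.E i S.L) = 0 := by
  rw [delbar_apply, ← metric_Nb]
  simp only [Fin.sum_univ_two, Eb_E]
  ring

lemma radial_lower (i : Fin 2) : S.radial (S.E i S.L) = 0 := by
  simp [radial_apply, delbar_lower]

lemma delbar_metric (h : Fin 2) : S.delbar h S.L = 0 := by
  have h1 := congrArg (S.delbar h) S.euler
  have h2 (i : Fin 2) : S.delbar h (S.η i) = 0 := by simp [delbar_apply, Zb_η, Eb_η]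
  simpa [Derivation.leibniz, delbar_lower, h2] using h1.symm

lemma radial_η (i : Fin 2) : S.radial (S.η i) = 0 := by
  simp [radial_apply', Zb_η, Eb_η]

lemma lower_Eb_N (m k : Fin 2) : ∑ i, S.E i S.L * S.Eb m (S.N i k) = 0 := by
  have h := congrArg (S.Eb m) (S.lower_N k)
  have h0 := S.metric_N m k
  simp only [Fin.sum_univ_two, map_add, Derivation.leibniz, smul_eq_mul, Eb_E, Z_Eb] at *
  linear_combination h - h0

lemma metric_E_N (l j k : Fin 2) :
    ∑ i, S.E i (S.Eb l S.L) * S.E j (S.N i k) = S.del k (S.E j (S.Eb l S.L)) := by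
  have h := congrArg (S.E j) (S.metric_N l k)
  rw [del_apply]
  simp only [Fin.sum_univ_two, map_add, Derivation.leibniz, smul_eq_mul, Z_E] at *
  rw [S.E_E 0 j, S.E_E 1 j]
  linear_combination h

lemma lower_E_N (l j : Fin 2) : ∑ i, S.E i S.L * S.E l (S.N i j) = S.del j (S.E l S.L) := by
  have h := congrArg (S.E l) (S.lower_N j)
  rw [del_apply]
  simp only [Fin.sum_univ_two, map_add, Derivation.leibniz, smul_eq_mul, Z_E] at *
  rw [S.E_E 0 l, S.E_E 1 l]
  linear_combination h

lemma lower_del_N (j k : Fin 2) :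
    ∑ l, S.E l S.L * S.del j (S.N l k) = ∑ l, S.E l S.L * S.del k (S.N l j) := by
  have h (j k : Fin 2) := congrArg (S.del j) (S.lower_N k)
  have hjk := h j k
  have hkj := h k j
  simp only [del_apply, Fin.sum_univ_two, map_add, Derivation.leibniz, smul_eq_mul, Z_E] at *
  rw [S.Z_Z j k, S.E_E 1 0] at hjk
  rw [S.E_E 1 0] at hkj
  linear_combination hjk - hkj

lemma radial_lower_N (k : Fin 2) :
    ∑ i, S.E i S.L * S.radial (S.N i k) = S.radial (S.Z k S.L) := by
  have h := congrArg S.radial (S.lower_N k)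
  simp only [Fin.sum_univ_two, map_add, Derivation.leibniz, smul_eq_mul, radial_lower] at *
  linear_combination h

lemma del_radial (j : Fin 2) (f : R) : S.del j (S.radial f) = S.radial (S.del j f) +
    ∑ i, S.radial (S.N i j) * S.E i f - ∑ i, S.del j (S.sprayBar i) * S.Eb i f := by
  have hη (i : Fin 2) : S.del j (S.ηb i) = 0 := by simp [del_apply, Z_ηb, E_ηb]
  have hc (i : Fin 2) : S.del j (S.Zb i f) =
      S.Zb i (S.del j f) + ∑ l, S.Zb i (S.N l j) * S.E l f := by
    simp only [del_apply, Fin.sum_univ_two, map_sub, map_add, Derivation.leibniz, smul_eq_mul,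
      Zb_Z, Zb_E]
    ring
  have hd (i : Fin 2) : S.del j (S.Eb i f) =
      S.Eb i (S.del j f) + ∑ l, S.Eb i (S.N l j) * S.E l f := by
    simp only [del_apply, Fin.sum_univ_two, map_sub, map_add, Derivation.leibniz, smul_eq_mul,
      Z_Eb, Eb_E]
    ring
  simp only [radial_apply', Fin.sum_univ_two, map_sub, map_add, Derivation.leibniz, smul_eq_mul,
      hη, hc, hd]
  ring

lemma E_radial (k : Fin 2) (f : R) : S.E k (S.radial f) = S.radial (S.E k f) -
    ∑ i, S.E k (S.sprayBar i) * S.Eb i f := by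
  simp only [radial_apply', Fin.sum_univ_two, map_sub, map_add, Derivation.leibniz, smul_eq_mul,
      E_ηb, Zb_E, Eb_E]
  ring

/-- The contracted Bianchi identity: `δ_j δ_0̄ (∂L/∂z^k)` is symmetric in `j` and `k`. -/
lemma del_radial_symm (j k : Fin 2) :
    S.del j (S.radial (S.Z k S.L)) = S.del k (S.radial (S.Z j S.L)) := by
  have key (j k : Fin 2) : S.del j (S.radial (S.Z k S.L)) =
      S.radial (∑ l, S.E l S.L * S.del j (S.N l k)) +
      ∑ l, S.del j (S.E l S.L) * S.radial (S.N l k) +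
      ∑ l, S.del k (S.E l S.L) * S.radial (S.N l j) := by
    have h0 := S.lower_Eb_N 0 k
    have h1 := S.lower_Eb_N 1 k
    rw [← radial_lower_N]
    simp only [← S.lower_E_N _ k]
    simp only [Fin.sum_univ_two, map_add, Derivation.leibniz, smul_eq_mul, radial_lower,
      del_radial] at *
    linear_combination - S.del j (S.sprayBar 0) * h0 - S.del j (S.sprayBar 1) * h1
  rw [key, key, lower_del_N]
  ring

/-- Differentiating `δ_0̄ (η^k ∂L/∂z^k) = -cL²` along the fibre. -/
lemma radial_add_eq (c : ℂ) (hX : S.radial (∑ k, S.η k * S.Z k S.L) = -(c • S.L ^ 2))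
    (k : Fin 2) :
    S.radial (S.Z k S.L) + ∑ s, (S.η s * S.radial (S.E k (S.Z s S.L)) -
      S.radial (S.E k (S.E s S.L)) * ∑ t, S.η t * S.N s t) =
      -(c • (2 * S.L * S.E k S.L)) := by
  have hE : S.E k (∑ s, S.η s * S.Z s S.L) = S.Z k S.L + ∑ s, S.η s * S.E k (S.Z s S.L) := by
    fin_cases k <;> simp [Derivation.leibniz, E_η] <;> ring
  have hEb (m : Fin 2) : S.Eb m (∑ s, S.η s * S.Z s S.L) =
      ∑ i, S.E i (S.Eb m S.L) * ∑ t, S.η t * S.N i t := by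
    have h0 := S.metric_N m 0
    have h1 := S.metric_N m 1
    simp only [Fin.sum_univ_two, map_add, Derivation.leibniz, smul_eq_mul, Eb_η, ← Z_Eb] at *
    linear_combination -S.η 0 * h0 - S.η 1 * h1
  have h (i : Fin 2) := S.E_radial k (S.E i S.L)
  have h0 := h 0
  have h1 := h 1
  have hk := congrArg (S.E k) hX
  rw [E_radial, hE] at hk
  simp only [hEb] at hk
  simp only [radial_lower, map_zero, Fin.sum_univ_two, map_neg, map_add, Derivation.map_smul, sq,
    Derivation.leibniz, smul_eq_mul, radial_η, Eb_E] at *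
  rw [← two_mul, ← mul_assoc] at hk
  linear_combination hk + (S.η 0 * S.N 0 0 + S.η 1 * S.N 0 1) * h0 +
    (S.η 0 * S.N 1 0 + S.η 1 * S.N 1 1) * h1

/-- The curvature component `R_{0̄ k h̄ s} η̄^h` in terms of derivatives of the metric. -/
lemma lower_curvature (k s : Fin 2) :
    ∑ i, (S.E i S.L * S.radial (S.E k (S.N i s)) + S.radial (S.N i s) * S.E i (S.E k S.L)) =
      S.radial (S.E k (S.Z s S.L)) - ∑ j, S.N j s * S.radial (S.E j (S.E k S.L)) := by
  have h := congrArg S.radial (S.lower_E_N k s)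
  simp only [del_apply, Fin.sum_univ_two, map_sub, map_add, Derivation.leibniz, smul_eq_mul, Z_E,
    radial_lower] at h ⊢
  linear_combination h

/-- Under the weak symmetry condition and constancy of the horizontal curvature invariant,
`δ_0̄ (∂L/∂z^k) = -c L ∂L/∂η^k`. -/
lemma radial_Z_metric (c : ℂ) (hX : S.radial (∑ k, S.η k * S.Z k S.L) = -(c • S.L ^ 2))
    (hsym : ∀ k, ∑ s, S.η s * ∑ i, (S.E i S.L * S.radial (S.E k (S.N i s)) +
        S.radial (S.N i s) * S.E i (S.E k S.L)) =
      ∑ s, S.η s * ∑ i, (S.E i S.L * S.radial (S.E s (S.N i k)) +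
        S.radial (S.N i k) * S.E i (S.E s S.L))) (k : Fin 2) :
    S.radial (S.Z k S.L) = -(c • (S.L * S.E k S.L)) := by
  have h1 := S.radial_add_eq c hX k
  have h2 := hsym k
  have e (i : Fin 2) : ∑ s, S.η s * S.radial (S.E i (S.E s S.L)) = 0 := by
    have h := congrArg S.radial (S.euler_lower i)
    simpa [Derivation.leibniz, radial_η] using h
  have er : ∑ s, S.η s * S.radial (S.E s (S.Z k S.L)) = S.radial (S.Z k S.L) := by
    have h := congrArg (fun f => S.radial (S.Z k f)) S.euler
    simpa [Derivation.leibniz, radial_η, Z_η, Z_E] using h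
  have e0 := e 0
  have e1 := e 1
  have hc : c • (2 * S.L * S.E k S.L) = 2 * (c • (S.L * S.E k S.L)) := by
    rw [mul_assoc, mul_smul_comm]
  have h2' : (2 : R) * S.radial (S.Z k S.L) = 2 * -(c • (S.L * S.E k S.L)) := by
    rw [hc] at h1
    simp only [lower_curvature] at h2
    simp only [Fin.sum_univ_two] at *
    rw [S.E_E 0 k, S.E_E 1 k] at h2
    linear_combination h1 - h2 - er + S.N 0 k * e0 + S.N 1 k * e1
  have h2'' := congrArg (fun f => (1 / 2 : ℂ) • f) h2'
  simpa [← smul_mul_assoc, Algebra.smul_def, ← mul_assoc, ← map_ofNat (algebraMap ℂ R) 2,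
    ← map_mul] using h2''

lemma lower_torsion (c : ℂ) (hc : c ≠ 0) (hL : IsUnit S.L)
    (h : ∀ k, S.radial (S.Z k S.L) = -(c • (S.L * S.E k S.L))) (j k : Fin 2) :
    ∑ i, S.E i S.L * S.E j (S.N i k) = ∑ i, S.E i S.L * S.E k (S.N i j) := by
  have hs := S.del_radial_symm k j
  simp only [h, map_neg, Derivation.map_smul, Derivation.leibniz, smul_eq_mul, del_metric,
    mul_zero, add_zero, neg_inj] at hs
  rw [lower_E_N, lower_E_N]
  exact hL.mul_left_cancel (smul_right_injective R hc hs)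

/-- The contraction `R_{0̄ j 0̄ k}` of the curvature tensor. -/
lemma contracted_curvature (C : Fin 2 → Fin 2 → Fin 2 → R)
    (hC : ∀ j l, ∑ i, S.E i S.L * C i j l = S.E l (S.E j S.L)) (j k : Fin 2) :
    ∑ r, ∑ h, (∑ i, S.E i (S.Eb r S.L) * (-S.delbar h (S.E j (S.N i k)) -
        ∑ l, S.delbar h (S.N l k) * C i j l)) * S.ηb r * S.ηb h =
      -∑ i, (S.E i S.L * S.radial (S.E j (S.N i k)) + S.radial (S.N i k) * S.E i (S.E j S.L)) := by
  have hC' (l : Fin 2) : ∑ i, (∑ m, S.E i (S.Eb m S.L) * S.ηb m) * C i j l = S.E l (S.E j S.L) := by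
    simpa only [lower_eq] using hC j l
  simp only [← hC', radial_apply, Fin.sum_univ_two]
  rw [← S.lower_eq 0, ← S.lower_eq 1]
  simp only [Fin.sum_univ_two]
  ring

lemma radial_of_holomorphic_curvature (c : ℂ) (F Finv J : R) (hF : F * F = S.L)
    (hFinv : F * Finv = 1)
    (hJ : J = ∑ j, ∑ k, ∑ i, S.η j * Finv * (S.η k * Finv) * (S.E i S.L * Finv) *
      S.E j (S.N i k))
    (hK : -Finv * S.radial J = algebraMap ℂ R c) :
    S.radial (∑ k, S.η k * S.Z k S.L) = -(c • S.L ^ 2) := by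
  have hX : ∑ k, S.η k * S.Z k S.L = F * F * F * J := by
    have hE (k : Fin 2) : ∑ j, S.η j * S.E j (S.Z k S.L) = S.Z k S.L := by
      have h := congrArg (S.Z k) S.euler
      simpa [Derivation.leibniz, Z_η, Z_E] using h
    have hl (j k : Fin 2) := S.lower_E_N j k
    have he (i : Fin 2) := S.euler_lower i
    have h00 := hl 0 0
    have h01 := hl 0 1
    have h10 := hl 1 0
    have h11 := hl 1 1
    have he0 := he 0
    have he1 := he 1
    have hE0 := hE 0
    have hE1 := hE 1
    have hJ' : F * F * F * J = ∑ j, ∑ k, S.η j * S.η k * ∑ i, S.E i S.L * S.E j (S.N i k) := by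
      calc F * F * F * J = (F * Finv) ^ 3 *
            ∑ j, ∑ k, S.η j * S.η k * ∑ i, S.E i S.L * S.E j (S.N i k) := by
            rw [hJ]
            simp only [Fin.sum_univ_two]
            ring
        _ = _ := by rw [hFinv]; ring
    rw [hJ']
    simp only [del_apply, Fin.sum_univ_two, Z_E] at *
    linear_combination -S.η 0 * hE0 - S.η 1 * hE1 - S.η 0 * S.η 0 * h00 - S.η 0 * S.η 1 * h01 -
      S.η 1 * S.η 0 * h10 - S.η 1 * S.η 1 * h11 +
      (S.η 0 * S.N 0 0 + S.η 1 * S.N 0 1) * he0 + (S.η 0 * S.N 1 0 + S.η 1 * S.N 1 1) * he1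
  have hL : S.radial S.L = 0 := by simp [radial_apply, delbar_metric]
  have hFr : S.radial F = 0 := by
    have h := congrArg S.radial hF
    rw [hL, Derivation.leibniz, smul_eq_mul, ← two_mul] at h
    have h2 : algebraMap ℂ R (1 / 2) * (Finv * (2 * (F * S.radial F))) = 0 := by rw [h]; simp
    have h3 : algebraMap ℂ R (1 / 2) * 2 = 1 := by
      rw [← map_ofNat (algebraMap ℂ R) 2, ← map_mul]
      simp
    linear_combination h2 - S.radial F * h3 - algebraMap ℂ R (1 / 2) * 2 * S.radial F * hFinv
  rw [hX]
  simp only [Derivation.leibniz, smul_eq_mul, hFr, Algebra.smul_def, ← hK]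
  rw [← hF]
  linear_combination -F * F * F * S.radial J * hFinv

end FinslerAlgebra

section Metric

variable {D : Set (Pt 2)}

/-- The derivation `∂/∂z^k`. -/
def derZ (hD : IsOpen D) (k : Fin 2) : Derivation ℂ (smoothAlgebra D) (smoothAlgebra D) :=
  wirtinger hD (Pi.single k 1, 0) (Pi.single k I, 0)

/-- The derivation `∂/∂z̄^k`. -/
def derZbar (hD : IsOpen D) (k : Fin 2) : Derivation ℂ (smoothAlgebra D) (smoothAlgebra D) :=
  wirtingerBar hD (Pi.single k 1, 0) (Pi.single k I, 0)

/-- The derivation `∂/∂η^k`. -/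
def derE (hD : IsOpen D) (k : Fin 2) : Derivation ℂ (smoothAlgebra D) (smoothAlgebra D) :=
  wirtinger hD (0, Pi.single k 1) (0, Pi.single k I)

/-- The derivation `∂/∂η̄^k`. -/
def derEbar (hD : IsOpen D) (k : Fin 2) : Derivation ℂ (smoothAlgebra D) (smoothAlgebra D) :=
  wirtingerBar hD (0, Pi.single k 1) (0, Pi.single k I)

lemma Represents.dz (hD : IsOpen D) {r : smoothAlgebra D} {f : Pt 2 → ℂ} (h : Represents r f)
    (k : Fin 2) : Represents (derZ hD k r) (dz f k) := fun p => by
  simp [derZ, wirtinger_apply, dirDeriv_apply hD _ h, CFinsler.dz]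

lemma Represents.dzbar (hD : IsOpen D) {r : smoothAlgebra D} {f : Pt 2 → ℂ} (h : Represents r f)
    (k : Fin 2) : Represents (derZbar hD k r) (dzbar f k) := fun p => by
  simp [derZbar, wirtingerBar_apply, dirDeriv_apply hD _ h, CFinsler.dzbar, mul_add]

lemma Represents.de (hD : IsOpen D) {r : smoothAlgebra D} {f : Pt 2 → ℂ} (h : Represents r f)
    (k : Fin 2) : Represents (derE hD k r) (de f k) := fun p => by
  simp [derE, wirtinger_apply, dirDeriv_apply hD _ h, CFinsler.de]

lemma Represents.debar (hD : IsOpen D) {r : smoothAlgebra D} {f : Pt 2 → ℂ} (h : Represents r f)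
    (k : Fin 2) : Represents (derEbar hD k r) (debar f k) := fun p => by
  simp [derEbar, wirtingerBar_apply, dirDeriv_apply hD _ h, CFinsler.debar, mul_add]

/-- The fibre coordinate `η^i`. -/
def fibreCoord (D : Set (Pt 2)) (i : Fin 2) : smoothAlgebra D :=
  smoothRestrict (fun p => p.2 i) (by fun_prop)

lemma represents_fibreCoord (i : Fin 2) : Represents (fibreCoord D i) (fun p => p.2 i) :=
  fun _ => rfl

lemma fderiv_fibreCoord (i : Fin 2) (p v : Pt 2) :
    fderiv ℝ (fun p : Pt 2 => p.2 i) p v = v.2 i := by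
  have h := ((ContinuousLinearMap.proj (R := ℝ) (φ := fun _ : Fin 2 => ℂ) i).comp
    (ContinuousLinearMap.snd ℝ (Fin 2 → ℂ) (Fin 2 → ℂ))).hasFDerivAt (x := p)
  exact congrArg (fun A => A v) h.fderiv

lemma derE_fibreCoord (hD : IsOpen D) (i j : Fin 2) :
    derE hD i (fibreCoord D j) = if i = j then 1 else 0 := by
  ext p
  rw [(represents_fibreCoord j).de hD i p]
  simp only [de, fderiv_fibreCoord, Pi.single_apply, eq_comm (a := j)]
  split_ifs
  · simp
    norm_num
  · simp

lemma derEbar_fibreCoord (hD : IsOpen D) (i j : Fin 2) : derEbar hD i (fibreCoord D j) = 0 := by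
  ext p
  rw [(represents_fibreCoord j).debar hD i p]
  simp only [debar, fderiv_fibreCoord, Pi.single_apply]
  split_ifs <;> simp

lemma derZ_fibreCoord (hD : IsOpen D) (i j : Fin 2) : derZ hD i (fibreCoord D j) = 0 := by
  ext p
  rw [(represents_fibreCoord j).dz hD i p]
  simp [dz, fderiv_fibreCoord]

lemma derZbar_fibreCoord (hD : IsOpen D) (i j : Fin 2) : derZbar hD i (fibreCoord D j) = 0 := by
  ext p
  rw [(represents_fibreCoord j).dzbar hD i p]
  simp [dzbar, fderiv_fibreCoord]

variable {L : Pt 2 → ℂ}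

namespace IsCFM

lemma fderiv_fibre_scaling (hL : IsCFM 2 D L) {p : Pt 2} (hp : p ∈ D) (w : ℂ) :
    fderiv ℝ L p (0, w • p.2) = 2 * w.re * L p := by
  have hd : HasFDerivAt L (fderiv ℝ L p) p :=
    ((hL.smooth.contDiffAt (hL.openD.mem_nhds hp)).differentiableAt (by simp)).hasFDerivAt
  have hscale : HasDerivAt (fun t : ℝ => 1 + (t : ℂ) * w) w 0 := by
    simpa using ((Complex.ofRealCLM.hasDerivAt (x := (0 : ℝ))).mul_const w).const_add 1
  have hcurve : HasDerivAt (fun t : ℝ => (p.1, (1 + (t : ℂ) * w) • p.2)) (0, w • p.2) 0 :=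
    (hasDerivAt_const 0 p.1).prodMk (hscale.smul_const p.2)
  have h1 : HasDerivAt (fun t : ℝ => L (p.1, (1 + (t : ℂ) * w) • p.2))
      (fderiv ℝ L p (0, w • p.2)) 0 := by
    refine HasFDerivAt.comp_hasDerivAt (0 : ℝ) ?_ hcurve
    simpa using hd
  have h2 : HasDerivAt (fun t : ℝ => (1 + (t : ℂ) * w) * (starRingEnd ℂ) (1 + (t : ℂ) * w) * L p)
      (2 * w.re * L p) 0 := by
    refine ((hscale.mul hscale.star).mul_const (L p)).congr_deriv ?_
    rw [← Complex.ofReal_ofNat 2, ← Complex.ofReal_mul, ← Complex.add_conj]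
    simp
  have hne : ∀ᶠ t : ℝ in nhds 0, 1 + (t : ℂ) * w ≠ 0 := by
    refine hscale.continuousAt.eventually_ne ?_
    simp
  refine h1.unique (h2.congr_of_eventuallyEq ?_)
  filter_upwards [hne] with t ht
  rw [hL.homog p hp _ ht, Complex.mul_conj]

lemma euler_pointwise (hL : IsCFM 2 D L) {p : Pt 2} (hp : p ∈ D) :
    ∑ i, p.2 i * de L i p = L p := by
  have h1 := hL.fderiv_fibre_scaling hp 1
  have hI := hL.fderiv_fibre_scaling hp I
  have hv (w : ℂ) : ((0, w • p.2) : Pt 2) = ∑ i, ((w * p.2 i).re • ((0, Pi.single i 1) : Pt 2) +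
      (w * p.2 i).im • ((0, Pi.single i I) : Pt 2)) := by
    ext i
    · simp
    · fin_cases i <;> apply Complex.ext <;> simp
  rw [hv] at h1 hI
  simp only [Fin.sum_univ_two, map_add, map_smul, Complex.real_smul, de] at *
  have e0 := Complex.re_add_im (p.2 0)
  have e1 := Complex.re_add_im (p.2 1)
  rw [← e0, ← e1]
  simp only [one_mul, Complex.mul_re, Complex.mul_im, I_re, I_im, one_re, zero_mul, zero_sub,
    zero_add, ofReal_neg, ofReal_zero, ofReal_one, mul_one, mul_zero] at h1 hI
  linear_combination (1 / 2) * h1 - I / 2 * hI - (1 / 2) *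
    ((p.2 0).im * fderiv ℝ L p (0, Pi.single 0 I) +
      (p.2 1).im * fderiv ℝ L p (0, Pi.single 1 I)) * I_sq

/-- The metric as a smooth function on its domain. -/
def metric (hL : IsCFM 2 D L) : smoothAlgebra D := smoothRestrict L hL.smooth

lemma represents_metric (hL : IsCFM 2 D L) : Represents hL.metric L := fun _ => rfl

lemma represents_gm (hL : IsCFM 2 D L) (i j : Fin 2) :
    Represents (derE hL.openD i (derEbar hL.openD j hL.metric)) (gm L i j) :=
  (hL.represents_metric.debar hL.openD j).de hL.openD i

lemma smoothConj_metric (hL : IsCFM 2 D L) : smoothConj hL.metric = hL.metric := by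
  ext p
  rw [smoothConj_apply, hL.represents_metric p]
  exact Complex.conj_eq_iff_im.2 (hL.real_im p p.2)

lemma det_gmat_ne_zero (hL : IsCFM 2 D L) {p : Pt 2} (hp : p ∈ D) : (gmat L p).det ≠ 0 := by
  intro h
  obtain ⟨v, hv, hv0⟩ := Matrix.exists_vecMul_eq_zero_iff.2 h
  have hpos := hL.posdef p hp v hv
  have h0 : ∑ i, ∑ j, gm L i j p * v i * (starRingEnd ℂ) (v j) =
      ∑ j, (Matrix.vecMul v (gmat L p)) j * (starRingEnd ℂ) (v j) := by
    simp [Matrix.vecMul, dotProduct, gmat]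
    ring
  rw [h0] at hpos
  simp [hv0] at hpos

lemma contDiffOn_gi (hL : IsCFM 2 D L) (l i : Fin 2) : ContDiffOn ℝ (⊤ : ℕ∞) (gi L l i) D := by
  have hg (i j : Fin 2) := (hL.represents_gm i j).contDiffOn
  have hdet : ContDiffOn ℝ (⊤ : ℕ∞) (fun p => ((gmat L p).det)⁻¹) D := by
    refine ContDiffOn.inv ?_ fun p hp => hL.det_gmat_ne_zero hp
    simp only [Matrix.det_fin_two, gmat]
    exact ((hg 0 0).mul (hg 1 1)).sub ((hg 0 1).mul (hg 1 0))
  have h : gi L l i = fun p => ((gmat L p).det)⁻¹ * (gmat L p).adjugate l i := by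
    ext p
    simp [gi, Matrix.inv_def]
  rw [h]
  refine hdet.mul ?_
  simp only [Matrix.adjugate_fin_two, gmat]
  fin_cases l <;> fin_cases i <;> simp <;> first | exact hg _ _ | exact (hg _ _).neg

/-- The inverse metric tensor. -/
def invMetric (hL : IsCFM 2 D L) (l i : Fin 2) : smoothAlgebra D :=
  smoothRestrict (gi L l i) (hL.contDiffOn_gi l i)

lemma sum_invMetric_mul (hL : IsCFM 2 D L) (m l : Fin 2) :
    ∑ i, hL.invMetric m i * derE hL.openD i (derEbar hL.openD l hL.metric) =
      if m = l then 1 else 0 := by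
  ext p
  have h := congrFun (congrFun (Matrix.nonsing_inv_mul (gmat L p)
    (hL.det_gmat_ne_zero p.2).isUnit) m) l
  rw [Matrix.mul_apply, Matrix.one_apply] at h
  have hg (i j : Fin 2) := hL.represents_gm i j p
  simp only [Fin.sum_univ_two] at h ⊢
  simp only [Subalgebra.coe_add, Subalgebra.coe_mul, Pi.add_apply, Pi.mul_apply, hg]
  refine h.trans ?_
  split_ifs <;> rfl

lemma sum_mul_invMetric (hL : IsCFM 2 D L) (i j : Fin 2) :
    ∑ l, derE hL.openD i (derEbar hL.openD l hL.metric) * hL.invMetric l j =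
      if i = j then 1 else 0 := by
  ext p
  have h := congrFun (congrFun (Matrix.mul_nonsing_inv (gmat L p)
    (hL.det_gmat_ne_zero p.2).isUnit) i) j
  rw [Matrix.mul_apply, Matrix.one_apply] at h
  have hg (i j : Fin 2) := hL.represents_gm i j p
  simp only [Fin.sum_univ_two] at h ⊢
  simp only [Subalgebra.coe_add, Subalgebra.coe_mul, Pi.add_apply, Pi.mul_apply, hg]
  refine h.trans ?_
  split_ifs <;> rfl

/-- The coefficients of the nonlinear connection as smooth functions. -/
def connection (hL : IsCFM 2 D L) (i k : Fin 2) : smoothAlgebra D :=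
  ∑ m, ∑ l, hL.invMetric m i *
    derZ hL.openD k (derE hL.openD l (derEbar hL.openD m hL.metric)) * fibreCoord D l

lemma euler_identity (hL : IsCFM 2 D L) :
    ∑ i, fibreCoord D i * derE hL.openD i hL.metric = hL.metric := by
  ext p
  have h := hL.euler_pointwise p.2
  have hd (i : Fin 2) := hL.represents_metric.de hL.openD i p
  have hf (i : Fin 2) := represents_fibreCoord i p
  simp only [Fin.sum_univ_two] at h ⊢
  simp only [Subalgebra.coe_add, Subalgebra.coe_mul, Pi.add_apply, Pi.mul_apply, hd, hf]
  exact h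

lemma metric_connection (hL : IsCFM 2 D L) (m k : Fin 2) :
    ∑ i, derE hL.openD i (derEbar hL.openD m hL.metric) * hL.connection i k =
      derZ hL.openD k (derEbar hL.openD m hL.metric) := by
  have h := congrArg (fun f => derZ hL.openD k (derEbar hL.openD m f)) hL.euler_identity
  have hcomm (j : Fin 2) : derEbar hL.openD m (derE hL.openD j hL.metric) =
    derE hL.openD j (derEbar hL.openD m hL.metric) := wirtingerBar_wirtinger_comm ..
  simp only [Fin.sum_univ_two, map_add, Derivation.leibniz, smul_eq_mul, derEbar_fibreCoord,
    derZ_fibreCoord, hcomm, mul_zero, add_zero] at h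
  have hi (l : Fin 2) := hL.sum_invMetric_mul l m
  have h0 := hi 0
  have h1 := hi 1
  simp only [connection, Fin.sum_univ_two] at *
  rw [← h]
  fin_cases m <;> simp at h0 h1 ⊢
  · linear_combination
      (derZ hL.openD k (derE hL.openD 0 (derEbar hL.openD 0 hL.metric)) * fibreCoord D 0 +
        derZ hL.openD k (derE hL.openD 1 (derEbar hL.openD 0 hL.metric)) * fibreCoord D 1) * h0 +
      (derZ hL.openD k (derE hL.openD 0 (derEbar hL.openD 1 hL.metric)) * fibreCoord D 0 +
        derZ hL.openD k (derE hL.openD 1 (derEbar hL.openD 1 hL.metric)) * fibreCoord D 1) * h1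
  · linear_combination
      (derZ hL.openD k (derE hL.openD 0 (derEbar hL.openD 0 hL.metric)) * fibreCoord D 0 +
        derZ hL.openD k (derE hL.openD 1 (derEbar hL.openD 0 hL.metric)) * fibreCoord D 1) * h0 +
      (derZ hL.openD k (derE hL.openD 0 (derEbar hL.openD 1 hL.metric)) * fibreCoord D 0 +
        derZ hL.openD k (derE hL.openD 1 (derEbar hL.openD 1 hL.metric)) * fibreCoord D 1) * h1

/-- The algebraic model of a two-dimensional complex Finsler metric. -/
def finslerAlgebra (hL : IsCFM 2 D L) : FinslerAlgebra (smoothAlgebra D) where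
  Z := derZ hL.openD
  Zb := derZbar hL.openD
  E := derE hL.openD
  Eb := derEbar hL.openD
  η := fibreCoord D
  ηb i := smoothConj (fibreCoord D i)
  L := hL.metric
  N := hL.connection
  Nb i k := smoothConj (hL.connection i k)
  Z_Z _ _ _ := wirtinger_comm ..
  E_E _ _ _ := wirtinger_comm ..
  Z_E _ _ _ := wirtinger_comm ..
  Z_Eb _ _ _ := (wirtingerBar_wirtinger_comm ..).symm
  Zb_E _ _ _ := wirtingerBar_wirtinger_comm ..
  Zb_Z _ _ _ := wirtingerBar_wirtinger_comm ..
  Eb_E _ _ _ := wirtingerBar_wirtinger_comm ..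
  E_η := derE_fibreCoord hL.openD
  Eb_η := derEbar_fibreCoord hL.openD
  Z_η := derZ_fibreCoord hL.openD
  Zb_η := derZbar_fibreCoord hL.openD
  E_ηb i j := by
    rw [← map_zero smoothConj, ← derEbar_fibreCoord hL.openD i j]
    exact (smoothConj_wirtingerBar ..).symm
  Z_ηb i j := by
    rw [← map_zero smoothConj, ← derZbar_fibreCoord hL.openD i j]
    exact (smoothConj_wirtingerBar ..).symm
  euler := hL.euler_identity
  euler_bar := by
    have h := congrArg smoothConj hL.euler_identity
    simp only [map_sum, map_mul, derE, smoothConj_wirtinger, smoothConj_metric] at h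
    exact h
  metric_N := hL.metric_connection
  metric_Nb i h := by
    have hm := congrArg smoothConj (hL.metric_connection i h)
    simp only [map_sum, map_mul, derE, derEbar, derZ, smoothConj_wirtinger,
      smoothConj_wirtingerBar, smoothConj_metric, wirtingerBar_wirtinger_comm] at hm
    exact hm.trans (wirtingerBar_wirtinger_comm ..).symm

/-- The coefficients `C^i_{jk}` as smooth functions. -/
def verticalConnection (hL : IsCFM 2 D L) (i j k : Fin 2) : smoothAlgebra D :=
  ∑ l, hL.invMetric l i * derE hL.openD k (derE hL.openD j (derEbar hL.openD l hL.metric))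

lemma represents_connection (hL : IsCFM 2 D L) (i k : Fin 2) :
    Represents (hL.connection i k) (Nc L i k) := fun p => by
  have hz (l m : Fin 2) := (hL.represents_gm l m).dz hL.openD k p
  have hf (i : Fin 2) := represents_fibreCoord i p
  have hi (l i : Fin 2) : (hL.invMetric l i).1 p = gi L l i p := rfl
  simp only [connection, Nc, Fin.sum_univ_two, Subalgebra.coe_add, Subalgebra.coe_mul,
    Pi.add_apply, Pi.mul_apply, hz, hf, hi]

lemma represents_del (hL : IsCFM 2 D L) {r : smoothAlgebra D} {f : Pt 2 → ℂ}
    (h : Represents r f) (k : Fin 2) : Represents (hL.finslerAlgebra.del k r) (del L f k) :=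
    fun p => by
  have hz := h.dz hL.openD k p
  have he (j : Fin 2) := h.de hL.openD j p
  have hn (j : Fin 2) := hL.represents_connection j k p
  rw [FinslerAlgebra.del_apply]
  simp only [del, Fin.sum_univ_two, ← hz, ← he, ← hn]
  rfl

lemma represents_delbar (hL : IsCFM 2 D L) {r : smoothAlgebra D} {f : Pt 2 → ℂ}
    (h : Represents r f) (k : Fin 2) :
    Represents (hL.finslerAlgebra.delbar k r) (delbar L f k) := fun p => by
  have hz := h.dzbar hL.openD k p
  have he (j : Fin 2) := h.debar hL.openD j p
  have hn (j : Fin 2) := hL.represents_connection j k p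
  rw [FinslerAlgebra.delbar_apply]
  simp only [delbar, Fin.sum_univ_two, ← hz, ← he, ← hn, ← smoothConj_apply]
  rfl

lemma represents_Cc (hL : IsCFM 2 D L) (i j k : Fin 2) :
    Represents (hL.verticalConnection i j k) (Cc L i j k) := fun p => by
  have he (l : Fin 2) := (hL.represents_gm j l).de hL.openD k p
  have hi (l i : Fin 2) : (hL.invMetric l i).1 p = gi L l i p := rfl
  simp only [Cc, Fin.sum_univ_two, ← he, ← hi]
  simp only [verticalConnection, Fin.sum_univ_two, Subalgebra.coe_add, Subalgebra.coe_mul,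
    Pi.add_apply, Pi.mul_apply]

lemma represents_Lc (hL : IsCFM 2 D L) (i j k : Fin 2) :
    Represents (hL.finslerAlgebra.E j (hL.finslerAlgebra.N i k)) (Lc L i j k) := fun p => by
  have hd (l : Fin 2) := hL.represents_del (hL.represents_gm j l) k p
  have hi (l i : Fin 2) : (hL.invMetric l i).1 p = gi L l i p := rfl
  have hm (l : Fin 2) := hL.finslerAlgebra.metric_E_N l j k
  have hg (i' : Fin 2) := hL.sum_mul_invMetric i' i
  have key : ∑ l, hL.invMetric l i *
      hL.finslerAlgebra.del k (derE hL.openD j (derEbar hL.openD l hL.metric)) =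
      hL.finslerAlgebra.E j (hL.finslerAlgebra.N i k) := by
    have hm0 := hm 0
    have hm1 := hm 1
    have hg0 := hg 0
    have hg1 := hg 1
    simp only [finslerAlgebra, Fin.sum_univ_two] at *
    rw [← hm0, ← hm1]
    fin_cases i <;> simp at hg0 hg1 ⊢
    · linear_combination derE hL.openD j (hL.connection 0 k) * hg0 +
        derE hL.openD j (hL.connection 1 k) * hg1
    · linear_combination derE hL.openD j (hL.connection 0 k) * hg0 +
        derE hL.openD j (hL.connection 1 k) * hg1
  rw [← key]
  simp only [Lc, Fin.sum_univ_two, ← hd, ← hi]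
  simp only [Subalgebra.coe_add, Subalgebra.coe_mul, Pi.add_apply, Pi.mul_apply]

lemma lower_verticalConnection (hL : IsCFM 2 D L) (j l : Fin 2) :
    ∑ i, hL.finslerAlgebra.E i hL.finslerAlgebra.L * hL.verticalConnection i j l =
      hL.finslerAlgebra.E l (hL.finslerAlgebra.E j hL.finslerAlgebra.L) := by
  have h := congrArg (hL.finslerAlgebra.E l) (hL.finslerAlgebra.lower_eq j)
  have hl (i : Fin 2) := hL.finslerAlgebra.lower_eq i
  have hi (m n : Fin 2) := hL.sum_invMetric_mul m n
  have h00 := hi 0 0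
  have h01 := hi 0 1
  have h10 := hi 1 0
  have h11 := hi 1 1
  rw [← h]
  simp only [← hl]
  simp only [verticalConnection, Fin.sum_univ_two, map_add, Derivation.leibniz, smul_eq_mul,
    FinslerAlgebra.E_ηb]
  simp only [finslerAlgebra, Fin.sum_univ_two, if_true, zero_ne_one, one_ne_zero, if_false] at *
  linear_combination
    derE hL.openD l (derE hL.openD j (derEbar hL.openD 0 hL.metric)) *
      (smoothConj (fibreCoord D 0) * h00 + smoothConj (fibreCoord D 1) * h01) +
    derE hL.openD l (derE hL.openD j (derEbar hL.openD 1 hL.metric)) *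
      (smoothConj (fibreCoord D 0) * h10 + smoothConj (fibreCoord D 1) * h11)

lemma Fh_ne_zero (hL : IsCFM 2 D L) {p : Pt 2} (hp : p ∈ D) : Fh L p ≠ 0 :=
  ofReal_ne_zero.2 (Real.sqrt_pos.2 (hL.pos p hp)).ne'

lemma contDiffOn_Fh (hL : IsCFM 2 D L) : ContDiffOn ℝ (⊤ : ℕ∞) (Fh L) D :=
  ofRealCLM.contDiff.comp_contDiffOn
    ((reCLM.contDiff.comp_contDiffOn hL.smooth).sqrt fun p hp => (hL.pos p hp).ne')

/-- The norm `F` as a smooth function. -/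
def root (hL : IsCFM 2 D L) : smoothAlgebra D := smoothRestrict (Fh L) hL.contDiffOn_Fh

/-- The reciprocal `1/F` as a smooth function. -/
def rootInv (hL : IsCFM 2 D L) : smoothAlgebra D :=
  smoothRestrict (fun p => (Fh L p)⁻¹) (hL.contDiffOn_Fh.inv fun _ => hL.Fh_ne_zero)

lemma root_mul_root (hL : IsCFM 2 D L) : hL.root * hL.root = hL.metric := by
  ext p
  change Fh L p * Fh L p = L p
  rw [Fh, ← ofReal_mul, Real.mul_self_sqrt (hL.pos p p.2).le]
  exact Complex.ext rfl (hL.real_im p p.2).symm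

lemma root_mul_rootInv (hL : IsCFM 2 D L) : hL.root * hL.rootInv = 1 := by
  ext p
  exact mul_inv_cancel₀ (hL.Fh_ne_zero p.2)

lemma isUnit_metric (hL : IsCFM 2 D L) : IsUnit hL.metric := by
  rw [← hL.root_mul_root]
  exact (IsUnit.of_mul_eq_one _ hL.root_mul_rootInv).mul
    (IsUnit.of_mul_eq_one _ hL.root_mul_rootInv)

lemma represents_ηb (hL : IsCFM 2 D L) (i : Fin 2) :
    Represents (hL.finslerAlgebra.ηb i) (fun p => (starRingEnd ℂ) (p.2 i)) := fun p =>
  smoothConj_apply (fibreCoord D i) p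

lemma sum_gm_mul_conj (hL : IsCFM 2 D L) (i : Fin 2) (p : D) :
    ∑ m, gm L i m p * (starRingEnd ℂ) (p.1.2 m) =
      (hL.finslerAlgebra.E i hL.finslerAlgebra.L).1 p := by
  have hg (m : Fin 2) := hL.represents_gm i m p
  have hb (m : Fin 2) := hL.represents_ηb m p
  rw [← hL.finslerAlgebra.lower_eq]
  simp only [Fin.sum_univ_two, ← hg, ← hb]
  rfl

/-- The connection scalar `J` as a smooth function. -/
def holomorphicScalar (hL : IsCFM 2 D L) : smoothAlgebra D :=
  ∑ j, ∑ k, ∑ i, fibreCoord D j * hL.rootInv * (fibreCoord D k * hL.rootInv) *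
    (hL.finslerAlgebra.E i hL.finslerAlgebra.L * hL.rootInv) *
    hL.finslerAlgebra.E j (hL.finslerAlgebra.N i k)

lemma represents_sJ (hL : IsCFM 2 D L) : Represents hL.holomorphicScalar (sJ L) := fun p => by
  have hl (i j k : Fin 2) := hL.represents_Lc i j k p
  have hg (i : Fin 2) := hL.sum_gm_mul_conj i p
  simp only [sJ, lup, llow, hg, ← hl, holomorphicScalar, Fin.sum_univ_two]
  rfl

lemma radial_spray (hL : IsCFM 2 D L) (c : ℂ) (hK : ∀ p ∈ D, hK L p = c) :
    hL.finslerAlgebra.radial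
        (∑ k, hL.finslerAlgebra.η k * hL.finslerAlgebra.Z k hL.finslerAlgebra.L) =
      -(c • hL.finslerAlgebra.L ^ 2) := by
  refine hL.finslerAlgebra.radial_of_holomorphic_curvature c hL.root hL.rootInv
    hL.holomorphicScalar hL.root_mul_root hL.root_mul_rootInv rfl ?_
  ext p
  refine Eq.trans ?_ (hK p p.2)
  have hd (k : Fin 2) := hL.represents_delbar hL.represents_sJ k p
  have hb (m : Fin 2) := hL.represents_ηb m p
  simp only [CFinsler.hK, FinslerAlgebra.radial_apply, Fin.sum_univ_two, ← hd, ← hb, one_div,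
    mul_comm _ ((hL.finslerAlgebra.ηb _).1 p)]
  rfl

/-- The curvature tensor `R_{r̄ j h̄ k}` as a smooth function. -/
def curvature (hL : IsCFM 2 D L) (r j h k : Fin 2) : smoothAlgebra D :=
  ∑ i, hL.finslerAlgebra.E i (hL.finslerAlgebra.Eb r hL.finslerAlgebra.L) *
    (-hL.finslerAlgebra.delbar h (hL.finslerAlgebra.E j (hL.finslerAlgebra.N i k)) -
      ∑ l, hL.finslerAlgebra.delbar h (hL.finslerAlgebra.N l k) * hL.verticalConnection i j l)

lemma represents_Rh (hL : IsCFM 2 D L) (r j h k : Fin 2) :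
    Represents (hL.curvature r j h k) (Rh L r j h k) := fun p => by
  have hg (i : Fin 2) := hL.represents_gm i r p
  have hl (i : Fin 2) := hL.represents_delbar (hL.represents_Lc i j k) h p
  have hn (l : Fin 2) := hL.represents_delbar (hL.represents_connection l k) h p
  have hc (i l : Fin 2) := hL.represents_Cc i j l p
  simp only [Rh, curvature, Fin.sum_univ_two, ← hg, ← hl, ← hn, ← hc]
  rfl

lemma curvature_symm (hL : IsCFM 2 D L) (hsym : WeakSym L D) (k : Fin 2) :
    ∑ s, hL.finslerAlgebra.η s *
        ∑ r, ∑ h, hL.curvature r k h s * hL.finslerAlgebra.ηb r * hL.finslerAlgebra.ηb h =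
      ∑ s, hL.finslerAlgebra.η s *
        ∑ r, ∑ h, hL.curvature r s h k * hL.finslerAlgebra.ηb r * hL.finslerAlgebra.ηb h := by
  ext p
  have hs := hsym p p.2 k
  have hr (r j h k : Fin 2) := hL.represents_Rh r j h k p
  have hb (m : Fin 2) := hL.represents_ηb m p
  have he (m : Fin 2) : (hL.finslerAlgebra.η m).1 p = p.1.2 m := rfl
  simp only [Fin.sum_univ_two, ← hr] at hs
  simp only [Fin.sum_univ_two, Subalgebra.coe_add, Subalgebra.coe_mul, Pi.add_apply, Pi.mul_apply,
    hb, he]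
  linear_combination hs

lemma lower_torsion (hL : IsCFM 2 D L) (hsym : WeakSym L D) (c : ℂ) (hc : c ≠ 0)
    (hK : ∀ p ∈ D, hK L p = c) (j k : Fin 2) :
    ∑ i, hL.finslerAlgebra.E i hL.finslerAlgebra.L *
        hL.finslerAlgebra.E j (hL.finslerAlgebra.N i k) =
      ∑ i, hL.finslerAlgebra.E i hL.finslerAlgebra.L *
        hL.finslerAlgebra.E k (hL.finslerAlgebra.N i j) := by
  refine hL.finslerAlgebra.lower_torsion c hc hL.isUnit_metric
    (hL.finslerAlgebra.radial_Z_metric c (hL.radial_spray c hK) fun k => ?_) j k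
  have hs := hL.curvature_symm hsym k
  simp only [curvature, hL.finslerAlgebra.contracted_curvature _ hL.lower_verticalConnection] at hs
  simp only [Fin.sum_univ_two] at hs ⊢
  linear_combination -hs

end IsCFM
end Metric

/-- connected, weak symmetry, `A` nowhere zero and `K` a nonzero
constant imply weakly Kähler. -/
theorem statement16 (D : Set (Pt 2)) (L : Pt 2 → ℂ) (hL : IsCFM 2 D L)
    (hconn : IsConnected D) (hsym : WeakSym L D)
    (hA : ∀ p ∈ D, sA L p ≠ 0)
    (c : ℝ) (hc : c ≠ 0) (hKc : ∀ p ∈ D, hK L p = (c : ℂ)) :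
    IsWeaklyKahler L D := by
  intro p hp k
  have ht (j : Fin 2) := congrArg (fun r : smoothAlgebra D => r.1 ⟨p, hp⟩)
    (hL.lower_torsion hsym c (ofReal_ne_zero.2 hc) hKc j k)
  have h0 := ht 0
  have h1 := ht 1
  have hl (i j k : Fin 2) := hL.represents_Lc i j k ⟨p, hp⟩
  have hg (i : Fin 2) := hL.sum_gm_mul_conj i ⟨p, hp⟩
  simp only [Fin.sum_univ_two, Subalgebra.coe_add, Subalgebra.coe_mul, Pi.add_apply, Pi.mul_apply,
    hl, ← hg] at h0 h1
  simp only [Fin.sum_univ_two]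
  linear_combination p.2 0 * h0 + p.2 1 * h1

end CFinsler
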